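/- Existence and uniqueness of reduced divisors: Let G be a graph and fix a base vertex v0 ∈ V(G). Then for every divisor D ∈ Div(G) there exists a unique v0-reduced divisor D' ∈ Div(G) with D' ∼ D. -/

import Mathlib

open Finset

variable {V : Type}

/-- Degree of a vertex in the multigraph with edge multiplicities `m`. -/
def mdeg [Fintype V] (m : V → V → ℕ) (v : V) : ℕ := ∑ w, m v w

/-- The Laplacian of an integer-valued function on the vertices. -/
def laplacian [Fintype V] (m : V → V → ℕ) (f : V → ℤ) : V → ℤ :=
  fun v => (mdeg m v : ℤ) * f v - ∑ w, (m v w : ℤ) * f w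

/-- Linear equivalence of divisors. -/
def LinEquiv [Fintype V] (m : V → V → ℕ) (D D' : V → ℤ) : Prop :=
  ∃ f : V → ℤ, D - D' = laplacian m f

/-- A divisor is effective if it is nonnegative everywhere. -/
def Effective (D : V → ℤ) : Prop := ∀ v, 0 ≤ D v

/-- Degree of a divisor. -/
def divDeg [Fintype V] (D : V → ℤ) : ℤ := ∑ v, D v

/-- `D` is linearly equivalent to some effective divisor. -/
def Winnable [Fintype V] (m : V → V → ℕ) (D : V → ℤ) : Prop :=
  ∃ E, Effective E ∧ LinEquiv m D E

/-- Number of edges of the multigraph. -/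
def edgeCount [Fintype V] (m : V → V → ℕ) : ℤ := (∑ v, ∑ w, (m v w : ℤ)) / 2

/-- The genus `g = |E| - |V| + 1`. -/
def genus [Fintype V] (m : V → V → ℕ) : ℤ := edgeCount m - Fintype.card V + 1

/-- `m` describes a graph: symmetric, loopless, and connected. -/
def IsGraph [Fintype V] (m : V → V → ℕ) : Prop :=
  (∀ v w, m v w = m w v) ∧ (∀ v, m v v = 0) ∧
  (SimpleGraph.fromRel (fun v w => 0 < m v w)).Connected


/-- `outdeg_A(v)`: the number of edges from `v` to vertices outside `A`. -/
def outdeg [Fintype V] [DecidableEq V] (m : V → V → ℕ) (A : Finset V) (v : V) : ℕ :=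
  ∑ w ∈ Aᶜ, m v w

/-- A divisor is `v0`-reduced if it is nonnegative away from `v0` and every nonempty
set `A` of vertices avoiding `v0` contains a vertex `v` with `D v < outdeg_A(v)`. -/
def Reduced [Fintype V] [DecidableEq V] (m : V → V → ℕ) (v0 : V) (D : V → ℤ) : Prop :=
  (∀ v, v ≠ v0 → 0 ≤ D v) ∧
  ∀ A : Finset V, A.Nonempty → v0 ∉ A → ∃ v ∈ A, D v < (outdeg m A v : ℤ)

lemma aux_lap [Fintype V] (m : V → V → ℕ) (f : V → ℤ) (v : V) :
    laplacian m f v = ∑ w, (m v w : ℤ) * (f v - f w) := by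
  simp only [laplacian, mdeg, mul_sub, Finset.sum_sub_distrib, Finset.sum_mul, Nat.cast_sum]

lemma aux_lap_add [Fintype V] (m : V → V → ℕ) (f g : V → ℤ) :
    laplacian m (f + g) = laplacian m f + laplacian m g := by
  funext v
  simp only [aux_lap, Pi.add_apply, ← Finset.sum_add_distrib]
  exact Finset.sum_congr rfl fun w _ => by ring

lemma aux_lap_smul [Fintype V] (m : V → V → ℕ) (c : ℤ) (f : V → ℤ) :
    laplacian m (fun v => c * f v) = fun v => c * laplacian m f v := by
  funext v
  simp only [aux_lap, Finset.mul_sum]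
  exact Finset.sum_congr rfl fun w _ => by ring

lemma aux_lap_neg [Fintype V] (m : V → V → ℕ) (f : V → ℤ) :
    laplacian m (-f) = - laplacian m f := by
  funext v
  simp only [aux_lap, Pi.neg_apply, ← Finset.sum_neg_distrib]
  exact Finset.sum_congr rfl fun w _ => by ring

lemma aux_selfadj [Fintype V] (m : V → V → ℕ) (hs : ∀ v w, m v w = m w v) (f h : V → ℤ) :
    ∑ v, laplacian m f v * h v = ∑ v, f v * laplacian m h v := by
  simp only [laplacian, sub_mul, mul_sub, Finset.sum_sub_distrib, Finset.sum_mul, Finset.mul_sum]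
  congr 1
  · exact Finset.sum_congr rfl fun w _ => by ring
  · rw [Finset.sum_comm]
    refine Finset.sum_congr rfl fun v _ => Finset.sum_congr rfl fun w _ => ?_
    rw [hs w v]; ring

lemma aux_max [Fintype V] [DecidableEq V] (m : V → V → ℕ) (v0 : V) (D1 D2 f : V → ℤ)
    (h1 : Reduced m v0 D1) (h2 : Reduced m v0 D2) (hf : D1 - D2 = laplacian m f) (w : V) :
    f w ≤ f v0 := by
  obtain ⟨x, -, hx⟩ := Finset.exists_max_image Finset.univ f ⟨v0, Finset.mem_univ _⟩
  by_contra hlt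
  have hv0 : f v0 ≠ f x := by have := hx w (Finset.mem_univ _); omega
  obtain ⟨v, hv, hvl⟩ := h1.2 (Finset.univ.filter fun u => f u = f x) ⟨x, by simp⟩ (by simpa using hv0)
  simp only [Finset.mem_filter, Finset.mem_univ, true_and] at hv
  have hne : v ≠ v0 := by rintro rfl; exact hv0 hv
  have e := congrFun hf v
  rw [aux_lap] at e
  have hle : (outdeg m (Finset.univ.filter fun u => f u = f x) v : ℤ)
      ≤ ∑ w, (m v w : ℤ) * (f v - f w) := by
    rw [outdeg, Nat.cast_sum]
    refine le_trans (Finset.sum_le_sum ?_) (Finset.sum_le_sum_of_subset_of_nonneg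
      (Finset.subset_univ _) ?_)
    · intro u hu
      simp only [Finset.mem_compl, Finset.mem_filter, Finset.mem_univ, true_and] at hu
      have := hx u (Finset.mem_univ _)
      exact le_mul_of_one_le_right (by positivity) (by omega)
    · intro u _ _
      have := hx u (Finset.mem_univ _)
      exact mul_nonneg (by positivity) (by omega)
  have := h2.1 v hne
  simp only [Pi.sub_apply] at e
  omega

lemma aux_potential [Fintype V] [DecidableEq V] (m : V → V → ℕ) (hm : IsGraph m) (v0 : V) :
    ∃ h : V → ℤ, h v0 = 0 ∧ (∀ v, 0 ≤ h v) ∧ ∀ v, v ≠ v0 → 1 ≤ laplacian m h v := by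
  obtain ⟨hs, hl, hc⟩ := hm
  set G := SimpleGraph.fromRel (fun v w => 0 < m v w) with hG
  let N : ℕ := ∑ v, G.dist v v0
  have hN : ∀ v, G.dist v v0 ≤ N := fun v =>
    Finset.single_le_sum (f := fun v => G.dist v v0) (fun _ _ => Nat.zero_le _) (Finset.mem_univ v)
  let K : ℤ := (∑ v, mdeg m v : ℕ) + 1
  have hK : 1 ≤ K := by simp only [K]; omega
  have hKd : ∀ v, (mdeg m v : ℤ) + 1 ≤ K := fun v => by
    have := Finset.single_le_sum (f := mdeg m) (fun _ _ => Nat.zero_le _) (Finset.mem_univ v)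
    simp only [K]; omega
  refine ⟨fun v => K ^ N - K ^ (N - G.dist v v0), by simp, fun v => ?_, fun v hv => ?_⟩
  · exact sub_nonneg.2 (pow_le_pow_right₀ hK (Nat.sub_le _ _))
  · obtain ⟨p, hp⟩ := hc.exists_walk_length_eq_dist v v0
    cases p with
    | nil => exact absurd rfl hv
    | @cons _ u _ hadj q =>
      have hq : G.dist u v0 ≤ q.length := SimpleGraph.dist_le q
      rw [SimpleGraph.Walk.length_cons] at hp
      have hmu : 0 < m v u := by
        rw [hG, SimpleGraph.fromRel_adj] at hadj
        rcases hadj.2 with h | h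
        · exact h
        · rw [hs]; exact h
      have hNv := hN v
      have hpos : ∀ n : ℕ, (1 : ℤ) ≤ K ^ n := fun n => one_le_pow₀ hK
      have e : laplacian m (fun v => K ^ N - K ^ (N - G.dist v v0)) v
          = (∑ w, (m v w : ℤ) * K ^ (N - G.dist w v0)) - mdeg m v * K ^ (N - G.dist v v0) := by
        rw [aux_lap, mdeg, Nat.cast_sum, Finset.sum_mul, ← Finset.sum_sub_distrib]
        exact Finset.sum_congr rfl fun w _ => by ring
      rw [e]
      have h1 : (m v u : ℤ) * K ^ (N - G.dist u v0) ≤ ∑ w, (m v w : ℤ) * K ^ (N - G.dist w v0) :=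
        Finset.single_le_sum (f := fun w => (m v w : ℤ) * K ^ (N - G.dist w v0))
          (fun w _ => mul_nonneg (by positivity) (by linarith [hpos (N - G.dist w v0)]))
          (Finset.mem_univ u)
      have h2 : K ^ (N - G.dist v v0) * K ≤ K ^ (N - G.dist u v0) := by
        rw [← pow_succ]
        exact pow_le_pow_right₀ hK (by omega)
      have h3 : K ^ (N - G.dist u v0) ≤ (m v u : ℤ) * K ^ (N - G.dist u v0) :=
        le_mul_of_one_le_left (by linarith [hpos (N - G.dist u v0)]) (by omega)
      have h4 := hpos (N - G.dist v v0)
      nlinarith [hKd v]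

lemma aux_fire [Fintype V] [DecidableEq V] (m : V → V → ℕ) (A : Finset V) (v : V) :
    laplacian m (fun u => if u ∈ A then 1 else 0) v ≤ if v ∈ A then (outdeg m A v : ℤ) else 0 := by
  rw [aux_lap]
  split_ifs with hv
  · rw [outdeg, Nat.cast_sum, ← Finset.sum_subset (Finset.subset_univ Aᶜ)]
    · refine Finset.sum_le_sum fun w hw => ?_
      simp [Finset.mem_compl.1 hw]
    · intro w _ hw
      simp only [Finset.mem_compl, not_not] at hw
      simp [hw]
  · refine Finset.sum_nonpos fun w _ => ?_
    split_ifs <;> simp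

theorem reduced_existsUnique [Fintype V] [DecidableEq V] (m : V → V → ℕ)
    (hm : IsGraph m) (v0 : V) (D : V → ℤ) :
    ∃! D' : V → ℤ, Reduced m v0 D' ∧ LinEquiv m D' D := by
  apply existsUnique_of_exists_of_unique
  · obtain ⟨h, h0, hnn, hlap⟩ := aux_potential m hm v0
    have hS : ∃ n : ℕ, ∃ D' : V → ℤ, LinEquiv m D' D ∧ (∀ v, v ≠ v0 → 0 ≤ D' v) ∧
        ∑ v, D' v * h v = n := by
      let c : ℤ := ∑ v, |D v|
      let E : V → ℤ := fun v => D v + c * laplacian m h v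
      have hE : ∀ v, v ≠ v0 → 0 ≤ E v := fun v hv => by
        have h1 : |D v| ≤ c := Finset.single_le_sum (f := fun v => |D v|)
          (fun _ _ => abs_nonneg _) (Finset.mem_univ v)
        have h2 := neg_abs_le (D v)
        have h3 := abs_nonneg (D v)
        have h4 := hlap v hv
        simp only [E]
        nlinarith
      have hP : 0 ≤ ∑ v, E v * h v := Finset.sum_nonneg fun v _ => by
        by_cases hv : v = v0
        · simp [hv, h0]
        · exact mul_nonneg (hE v hv) (hnn v)
      refine ⟨(∑ v, E v * h v).toNat, E, ⟨fun v => c * h v, ?_⟩, hE, (Int.toNat_of_nonneg hP).symm⟩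
      rw [aux_lap_smul]
      funext v
      simp [E]
    classical
    obtain ⟨D', ⟨f, hf⟩, hD', hn⟩ := Nat.find_spec hS
    refine ⟨D', ⟨hD', fun A hA hv0 => ?_⟩, f, hf⟩
    by_contra hcon
    push Not at hcon
    let χ : V → ℤ := fun u => if u ∈ A then 1 else 0
    let E : V → ℤ := D' - laplacian m χ
    have hE : ∀ v, v ≠ v0 → 0 ≤ E v := fun v hv => by
      have h1 := aux_fire m A v
      have h2 := hD' v hv
      simp only [E, Pi.sub_apply, χ]
      split_ifs at h1 with hvA
      · have := hcon v hvA
        linarith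
      · linarith
    have hP : 0 ≤ ∑ v, E v * h v := Finset.sum_nonneg fun v _ => by
      by_cases hv : v = v0
      · simp [hv, h0]
      · exact mul_nonneg (hE v hv) (hnn v)
    have hdec : ∑ v, E v * h v < ∑ v, D' v * h v := by
      have e : ∑ v, E v * h v = ∑ v, D' v * h v - ∑ v, χ v * laplacian m h v := by
        rw [← aux_selfadj m hm.1, ← Finset.sum_sub_distrib]
        exact Finset.sum_congr rfl fun v _ => by simp only [E, Pi.sub_apply]; ring
      have : 0 < ∑ v, χ v * laplacian m h v := by
        simp only [χ, ite_mul, one_mul, zero_mul, Finset.sum_ite_mem, Finset.univ_inter]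
        refine Finset.sum_pos (fun v hv => ?_) hA
        have := hlap v (fun hh => hv0 (hh ▸ hv))
        omega
      linarith
    refine Nat.find_min hS (m := (∑ v, E v * h v).toNat) (by omega)
      ⟨E, ⟨f + -χ, ?_⟩, hE, (Int.toNat_of_nonneg hP).symm⟩
    rw [aux_lap_add, aux_lap_neg, ← hf]
    simp only [E]
    abel
  · rintro D1 D2 ⟨h1, f1, hf1⟩ ⟨h2, f2, hf2⟩
    have e : D1 - D2 = laplacian m (f1 + -f2) := by
      rw [aux_lap_add, aux_lap_neg, ← hf1, ← hf2]; abel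
    have e' : D2 - D1 = laplacian m (-(f1 + -f2)) := by
      rw [aux_lap_neg, ← e]; abel
    have a := aux_max m v0 D1 D2 _ h1 h2 e
    have b := aux_max m v0 D2 D1 _ h2 h1 e'
    have hc : ∀ w, (f1 + -f2) w = (f1 + -f2) v0 := fun w =>
      le_antisymm (a w) (by simpa only [Pi.neg_apply, neg_le_neg_iff] using b w)
    have : D1 - D2 = 0 := by
      rw [e]; funext v; rw [aux_lap]
      refine Finset.sum_eq_zero fun w _ => ?_
      rw [hc v, hc w]; simp
    exact sub_eq_zero.1 this
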